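/- Let Σ be a set of identities and V = Mod(Σ) the variety it axiomatizes. If every member of V is abelian and some member of V is not affine (i.e., some member of V has no Maltsev polynomial operation), then there exists an algebra B in V with more than one element such that every algebra obtainable as a surjective-homomorphic image of a substructure of a product of copies of B is strongly abelian (i.e., the subvariety of V generated by B is a nontrivial strongly abelian variety). -/

import Mathlib

namespace UA

/-- An algebraic language: a type of operation symbols with arities. -/
structure Lang where
  F : Type
  arity : F → ℕ

variable {L : Lang}

/-- An interpretation of the language `L` on the carrier `A` (an algebra structure). -/
def Interp (L : Lang) (A : Type) : Type :=
  (f : L.F) → ((Fin (L.arity f)) → A) → A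

/-- Terms of the language `L` over a type `X` of variables. -/
inductive Term (L : Lang) (X : Type) : Type
  | var : X → Term L X
  | app : (f : L.F) → ((Fin (L.arity f)) → Term L X) → Term L X

/-- Realization of a term under an assignment of the variables. -/
def Term.realize {A X : Type} (I : Interp L A) (v : X → A) : Term L X → A
  | .var x => v x
  | .app f ts => I f (fun i => (ts i).realize I v)

/-- Relabelling (substitution of variables) of terms. -/
def Term.relabel {X Y : Type} (g : X → Y) : Term L X → Term L Y
  | .var x => .var (g x)
  | .app f ts => .app f (fun i => (ts i).relabel g)

/-- `p` is a polynomial operation of the algebra `(A, I)` with argument-index type `X`: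
it is the realization of a term in variables `X ⊕ Fin m` where the `Fin m` variables
are evaluated at fixed constants. -/
def IsPolyOp {A X : Type} (I : Interp L A) (p : (X → A) → A) : Prop :=
  ∃ (m : ℕ) (t : Term L (X ⊕ Fin m)) (c : Fin m → A),
    ∀ x : X → A, p x = t.realize I (Sum.elim x c)

/-- A unary polynomial operation. -/
def IsUnaryPolyOp {A : Type} (I : Interp L A) (g : A → A) : Prop :=
  IsPolyOp I (fun x : Fin 1 → A => g (x 0))

/-- `(p, q, r, s)` is a `1,1`-matrix of the algebra `(A, I)`. -/
def Is11Matrix {A : Type} (I : Interp L A) (p q r s : A) : Prop :=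
  ∃ (k l : ℕ) (t : ((Fin k ⊕ Fin l) → A) → A), IsPolyOp I t ∧
    ∃ (a b : Fin k → A) (u v : Fin l → A),
      p = t (Sum.elim a u) ∧ q = t (Sum.elim a v) ∧
      r = t (Sum.elim b u) ∧ s = t (Sum.elim b v)

/-- The algebra is abelian: in every `1,1`-matrix, `p = q` implies `r = s`. -/
def IsAbelian {A : Type} (I : Interp L A) : Prop :=
  ∀ p q r s : A, Is11Matrix I p q r s → p = q → r = s

/-- The algebra is strongly rectangular: in every `1,1`-matrix, `q = r` implies `r = s`. -/
def IsStronglyRectangular {A : Type} (I : Interp L A) : Prop :=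
  ∀ p q r s : A, Is11Matrix I p q r s → q = r → r = s

/-- Strongly abelian = abelian + strongly rectangular. -/
def IsStronglyAbelian {A : Type} (I : Interp L A) : Prop :=
  IsAbelian I ∧ IsStronglyRectangular I

/-- The algebra has a Maltsev polynomial operation. -/
def HasMaltsevPoly {A : Type} (I : Interp L A) : Prop :=
  ∃ mOp : (Fin 3 → A) → A, IsPolyOp I mOp ∧
    ∀ x y : A, mOp ![x, y, y] = x ∧ mOp ![y, y, x] = x

/-- Affine = abelian + has a Maltsev polynomial operation. -/
def IsAffine {A : Type} (I : Interp L A) : Prop :=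
  IsAbelian I ∧ HasMaltsevPoly I

/-- The algebra satisfies the identity `e.1 ≈ e.2`. -/
def Satisfies {A : Type} (I : Interp L A) (e : Term L ℕ × Term L ℕ) : Prop :=
  ∀ v : ℕ → A, e.1.realize I v = e.2.realize I v

/-- Membership in the variety `Mod(E)` axiomatized by the set `E` of identities. -/
def InVariety {A : Type} (E : Set (Term L ℕ × Term L ℕ)) (I : Interp L A) : Prop :=
  ∀ e ∈ E, Satisfies I e

/-- `θ` is a congruence on the algebra `(A, I)`. -/
def IsCong {A : Type} (I : Interp L A) (θ : A → A → Prop) : Prop :=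
  Equivalence θ ∧
    ∀ (f : L.F) (a b : Fin (L.arity f) → A),
      (∀ i, θ (a i) (b i)) → θ (I f a) (I f b)

/-- `(p, q, r, s)` is a `θ`-matrix of the algebra `(A, I)`. -/
def IsThetaMatrix {A : Type} (I : Interp L A) (θ : A → A → Prop) (p q r s : A) : Prop :=
  ∃ (k l : ℕ) (t : ((Fin k ⊕ Fin l) → A) → A), IsPolyOp I t ∧
    ∃ (a b : Fin k → A) (u v : Fin l → A),
      (∀ i, θ (a i) (b i)) ∧ (∀ j, θ (u j) (v j)) ∧
      p = t (Sum.elim a u) ∧ q = t (Sum.elim a v) ∧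
      r = t (Sum.elim b u) ∧ s = t (Sum.elim b v)

/-- `θ` is a strongly abelian congruence. -/
def IsStronglyAbelianCong {A : Type} (I : Interp L A) (θ : A → A → Prop) : Prop :=
  ∀ p q r s : A, IsThetaMatrix I θ p q r s → (p = q → r = s) ∧ (q = r → r = s)

/-- `S` is a subuniverse of the algebra `(A, I)`. -/
def IsSubuniverse {A : Type} (I : Interp L A) (S : Set A) : Prop :=
  ∀ (f : L.F) (a : Fin (L.arity f) → A), (∀ i, a i ∈ S) → I f a ∈ S

/-- The substructure (restricted algebra structure) on a subuniverse. -/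
def subInterp {A : Type} (I : Interp L A) (S : Set A) (hS : IsSubuniverse I S) :
    Interp L S :=
  fun f a => ⟨I f (fun i => (a i : A)), hS f _ (fun i => (a i).2)⟩

/-- The componentwise algebra structure on a product. -/
def prodInterp {ι : Type} {A : ι → Type} (I : ∀ i, Interp L (A i)) :
    Interp L (∀ i, A i) :=
  fun f a i => I i f (fun j => a j i)

/-- The componentwise algebra structure on `A × A`. -/
def pairInterp {A : Type} (I : Interp L A) : Interp L (A × A) :=
  fun f a => (I f (fun i => (a i).1), I f (fun i => (a i).2))

/-- `h` is a homomorphism of `L`-algebras. -/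
def IsHom {A B : Type} (I : Interp L A) (J : Interp L B) (h : A → B) : Prop :=
  ∀ (f : L.F) (a : Fin (L.arity f) → A), h (I f a) = J f (fun i => h (a i))

/-- The induced algebra structure on the quotient by a congruence `ρ`
(well-defined, i.e. independent of the chosen representatives, when `ρ` is a congruence). -/
noncomputable def quotInterp {A : Type} (I : Interp L A) (ρ : A → A → Prop) :
    Interp L (Quot ρ) :=
  fun f a => Quot.mk ρ (I f (fun i => (a i).out))

/-- The subuniverse generated by a subset `G`: the intersection of all
subuniverses containing `G`. -/
def GenSub {A : Type} (I : Interp L A) (G : Set A) : Set A :=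
  {x | ∀ S : Set A, IsSubuniverse I S → G ⊆ S → x ∈ S}

theorem genSub_isSubuniverse {A : Type} (I : Interp L A) (G : Set A) :
    IsSubuniverse I (GenSub I G) :=
  fun f a ha S hS hG => hS f a (fun i => ha i S hS hG)

/-- The smallest congruence containing the pair `(x, y)`: the intersection of all
congruences containing it. -/
def genCong {A : Type} (I : Interp L A) (x y : A) : A → A → Prop :=
  fun w z => ∀ ρ : A → A → Prop, IsCong I ρ → ρ x y → ρ w z

/-- The carrier of `A(θ)`, the graph of `θ` inside `A × A`. -/
abbrev ThetaSub {A : Type} (θ : A → A → Prop) : Type := {z : A × A // θ z.1 z.2}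

/-- The substructure `A(θ) ≤ A × A` supported by the graph of `θ`. -/
def thetaSubInterp {A : Type} (I : Interp L A) (θ : A → A → Prop) (hθ : IsCong I θ) :
    Interp L (ThetaSub θ) :=
  fun f a => ⟨(I f (fun i => (a i).1.1), I f (fun i => (a i).1.2)),
    hθ.2 f _ _ (fun i => (a i).2)⟩

/-- The diagonal element `(c, c)` of `A(θ)`. -/
def diagEl {A : Type} {θ : A → A → Prop} (hrefl : ∀ a : A, θ a a) (c : A) :
    ThetaSub θ := ⟨(c, c), hrefl c⟩

/-- `Δ`: the smallest congruence of `A(θ)` containing `D × D`, where `D` is the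
diagonal -- the intersection of all congruences of `A(θ)` containing `D × D`. -/
def DeltaRel {A : Type} (I : Interp L A) (θ : A → A → Prop) (hθ : IsCong I θ) :
    ThetaSub θ → ThetaSub θ → Prop :=
  fun x y => ∀ ρ : ThetaSub θ → ThetaSub θ → Prop,
    IsCong (thetaSubInterp I θ hθ) ρ →
    (∀ c d : A, ρ (diagEl hθ.1.refl c) (diagEl hθ.1.refl d)) → ρ x y

/-- The quotient algebra `S = A(θ)/Δ`. -/
noncomputable def SInterp {A : Type} (I : Interp L A) (θ : A → A → Prop)
    (hθ : IsCong I θ) : Interp L (Quot (DeltaRel I θ hθ)) :=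
  quotInterp (thetaSubInterp I θ hθ) (DeltaRel I θ hθ)

/-- The element `0` of `S = A(θ)/Δ`: the `Δ`-class of a diagonal element. -/
def zeroS {A : Type} (I : Interp L A) (θ : A → A → Prop) (hθ : IsCong I θ) (d : A) :
    Quot (DeltaRel I θ hθ) :=
  Quot.mk _ (diagEl hθ.1.refl d)

/-- The diagonal of `B × B`. -/
def diagSet (B : Type) : Set (B × B) := {z | z.1 = z.2}

/-- The set of pairs `(u j, v j)`. -/
def pairsSet {B : Type} {l : ℕ} (u v : Fin l → B) : Set (B × B) :=
  {z | ∃ j, z = (u j, v j)}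

/-- The carrier of the subalgebra `C ≤ B × B` generated by the diagonal and the
pairs `(u j, v j)`. -/
def CsetOf {L : Lang} {B : Type} (I : Interp L B) {l : ℕ} (u v : Fin l → B) :
    Set (B × B) :=
  GenSub (pairInterp I) (diagSet B ∪ pairsSet u v)

/-- The subalgebra `C ≤ B × B` generated by the diagonal and the pairs `(u j, v j)`. -/
def CInterpOf {L : Lang} {B : Type} (I : Interp L B) {l : ℕ} (u v : Fin l → B) :
    Interp L (CsetOf I u v) :=
  subInterp (pairInterp I) _ (genSub_isSubuniverse _ _)


/-- The absolutely free algebra of terms. -/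
def termInterp (L : Lang) (Y : Type) : Interp L (Term L Y) := fun f ts => .app f ts

theorem IsHom.realize {A B X : Type} {I : Interp L A} {J : Interp L B} {h : A → B}
    (hh : IsHom I J h) (v : X → A) (t : Term L X) :
    h (t.realize I v) = t.realize J (fun x => h (v x)) := by
  induction t with
  | var x => rfl
  | app f ts ih =>
    simp only [Term.realize]
    rw [hh f]
    simp only [ih]

theorem isHom_realize {A X : Type} (I : Interp L A) (v : X → A) :
    IsHom (termInterp L X) I (Term.realize I v) := fun _ _ => rfl

/-- Substitution followed by evaluation is evaluation at the evaluated arguments. -/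
theorem realize_realize {A X Y : Type} (I : Interp L A) (v : Y → A) (σ : X → Term L Y)
    (t : Term L X) :
    (t.realize (termInterp L Y) σ).realize I v = t.realize I (fun x => (σ x).realize I v) :=
  (isHom_realize I v).realize σ t

theorem realize_relabel {A X Y : Type} (I : Interp L A) (g : X → Y) (v : Y → A)
    (t : Term L X) : (t.relabel g).realize I v = t.realize I (fun x => v (g x)) := by
  induction t with
  | var x => rfl
  | app f ts ih => simp only [Term.relabel, Term.realize, ih]

/-- Every term is a relabelling of a term in finitely many variables. -/
theorem exists_relabel_fin {X : Type} (t : Term L X) :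
    ∃ (n : ℕ) (t' : Term L (Fin n)) (g : Fin n → X), t'.relabel g = t := by
  induction t with
  | var x => exact ⟨1, .var 0, fun _ => x, rfl⟩
  | app f ts ih =>
    choose n t' g h using ih
    refine ⟨∑ i, n i, .app f (fun i => (t' i).relabel (fun j => finSigmaFinEquiv ⟨i, j⟩)),
      fun k => g (finSigmaFinEquiv.symm k).1 (finSigmaFinEquiv.symm k).2, ?_⟩
    have key : ∀ {X Y Z : Type} (a : X → Y) (b : Y → Z) (s : Term L X),
        (s.relabel a).relabel b = s.relabel (fun x => b (a x)) := by
      intro X Y Z a b s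
      induction s with
      | var x => rfl
      | app f ts ih => simp only [Term.relabel, ih]
    simp only [Term.relabel, key]
    congr 1
    funext i
    rw [← h i]
    congr 1
    funext j
    rw [finSigmaFinEquiv.symm_apply_apply ⟨i, j⟩]

/-- The four assignments differ from each other as the entries of a `1,1`-matrix do:
each variable is constant along the rows or along the columns. -/
def IsGrid {A X : Type} (v₀₀ v₀₁ v₁₀ v₁₁ : X → A) : Prop :=
  ∀ x, (v₀₀ x = v₀₁ x ∧ v₁₀ x = v₁₁ x) ∨ (v₀₀ x = v₁₀ x ∧ v₀₁ x = v₁₁ x)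

theorem IsAbelian.realize_eq {A X : Type} {I : Interp L A} (hI : IsAbelian I)
    (t : Term L X) {v₀₀ v₀₁ v₁₀ v₁₁ : X → A} (hv : IsGrid v₀₀ v₀₁ v₁₀ v₁₁)
    (h : t.realize I v₀₀ = t.realize I v₀₁) : t.realize I v₁₀ = t.realize I v₁₁ := by
  classical
  obtain ⟨n, s, g, rfl⟩ := exists_relabel_fin t
  simp only [realize_relabel] at h ⊢
  let R : Fin n → Prop := fun i => v₀₀ (g i) = v₀₁ (g i) ∧ v₁₀ (g i) = v₁₁ (g i)
  let c : Fin n → (Fin n ⊕ Fin n) ⊕ Fin 0 := fun i => .inl (if R i then .inl i else .inr i)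
  have hC : ∀ i, ¬ R i → v₀₀ (g i) = v₁₀ (g i) ∧ v₀₁ (g i) = v₁₁ (g i) :=
    fun i hi => (hv (g i)).resolve_left hi
  refine hI _ _ _ _ ⟨n, n, fun x => s.realize I (fun i => Sum.elim x Fin.elim0 (c i)),
    ⟨0, s.relabel c, Fin.elim0, fun x => (realize_relabel _ _ _ _).symm⟩,
    fun i => v₀₀ (g i), fun i => v₁₀ (g i), fun i => v₀₀ (g i), fun i => v₀₁ (g i),
    ?_, ?_, ?_, ?_⟩ h
  all_goals
    congr 1
    funext i
    by_cases hi : R i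
    · have := hi
      simp [c, hi, this.1, this.2]
    · have := hC i hi
      simp [c, hi, this.1, this.2]

theorem quot_mk_eq_iff {A : Type} {I : Interp L A} {ρ : A → A → Prop} (hρ : IsCong I ρ)
    {a b : A} : Quot.mk ρ a = Quot.mk ρ b ↔ ρ a b := by
  constructor
  · intro h
    exact (hρ.1.eqvGen_iff).1 (Quot.eqvGen_exact h)
  · exact Quot.sound

theorem isHom_quot_mk {A : Type} {I : Interp L A} {ρ : A → A → Prop} (hρ : IsCong I ρ) :
    IsHom I (quotInterp I ρ) (Quot.mk ρ) := by
  intro f a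
  refine Quot.sound (hρ.2 f _ _ fun i => ?_)
  rw [← quot_mk_eq_iff hρ]
  exact (Quot.out_eq _).symm

theorem InVariety.quot {A : Type} {I : Interp L A} {ρ : A → A → Prop} (hρ : IsCong I ρ)
    {E : Set (Term L ℕ × Term L ℕ)}
    (hE : ∀ e ∈ E, ∀ v : ℕ → A, ρ (e.1.realize I v) (e.2.realize I v)) :
    InVariety E (quotInterp I ρ) := by
  intro e he v
  have hv : v = fun n => Quot.mk ρ (v n).out := funext fun n => (Quot.out_eq _).symm
  rw [hv, ← (isHom_quot_mk hρ).realize, ← (isHom_quot_mk hρ).realize]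
  exact Quot.sound (hE e he _)

/-- Evaluation of a unary polynomial, given as a term with constants and one hole. -/
def plug {A : Type} (I : Interp L A) (w : Term L (Option A)) (a : A) : A :=
  w.realize I (fun o => o.elim a id)

/-- The syntactic congruence of a subset: the largest congruence saturating it. -/
def synRel {A : Type} (I : Interp L A) (Q : Set A) (a b : A) : Prop :=
  ∀ w : Term L (Option A), plug I w a ∈ Q ↔ plug I w b ∈ Q

theorem synRel.mem_iff {A : Type} {I : Interp L A} {Q : Set A} {a b : A}
    (h : synRel I Q a b) : a ∈ Q ↔ b ∈ Q := h (.var none)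

theorem synRel_isCong {A : Type} (I : Interp L A) (Q : Set A) : IsCong I (synRel I Q) := by
  classical
  refine ⟨⟨fun _ _ => Iff.rfl, fun h w => (h w).symm, fun h h' w => (h w).trans (h' w)⟩, ?_⟩
  intro f a b hab w
  have key : ∀ s : Finset (Fin (L.arity f)),
      plug I w (I f a) ∈ Q ↔ plug I w (I f (s.piecewise b a)) ∈ Q := by
    intro s
    induction s using Finset.induction_on with
    | empty => simp
    | insert i s hi ih =>
      rw [ih]
      have hctx := hab i (w.realize (termInterp L (Option A)) (fun o => o.elim
        (.app f (fun j => if j = i then .var none else .var (some (s.piecewise b a j))))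
        (fun c => .var (some c))))
      have hplug : ∀ c : A, plug I (w.realize (termInterp L (Option A)) (fun o => o.elim
          (.app f (fun j => if j = i then .var none else .var (some (s.piecewise b a j))))
          (fun c => .var (some c)))) c =
          plug I w (I f (fun j => if j = i then c else s.piecewise b a j)) := by
        intro c
        unfold plug
        rw [realize_realize]
        congr 1
        funext o
        cases o with
        | none =>
          simp only [Option.elim, Term.realize]
          congr 1
          funext j
          split <;> rfl
        | some d => rfl
      rw [hplug, hplug] at hctx
      convert hctx using 5 with j j
      · split_ifs with hj
        · subst hj; simp [hi]
        · rfl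
      · split_ifs with hj
        · subst hj; simp
        · simp [hj]
  simpa using key Finset.univ

/-- In an abelian variety, the syntactic congruence of any subset satisfies the term
condition. -/
theorem synRel.term_condition {A X : Type} {E : Set (Term L ℕ × Term L ℕ)}
    (hab : ∀ (A : Type) (I : Interp L A), InVariety E I → IsAbelian I)
    {I : Interp L A} {Q : Set A}
    (hE : ∀ e ∈ E, ∀ v : ℕ → A, synRel I Q (e.1.realize I v) (e.2.realize I v))
    (t : Term L X) {v₀₀ v₀₁ v₁₀ v₁₁ : X → A} (hv : IsGrid v₀₀ v₀₁ v₁₀ v₁₁)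
    (h : synRel I Q (t.realize I v₀₀) (t.realize I v₀₁)) :
    t.realize I v₁₀ ∈ Q ↔ t.realize I v₁₁ ∈ Q := by
  have hρ := synRel_isCong I Q
  refine synRel.mem_iff (I := I) ?_
  rw [← quot_mk_eq_iff hρ] at h ⊢
  rw [(isHom_quot_mk hρ).realize, (isHom_quot_mk hρ).realize] at h ⊢
  refine (hab _ _ (InVariety.quot hρ hE)).realize_eq t (fun x => ?_) h
  rcases hv x with h | h <;> simp [h.1, h.2]

/-- Terms with the same values at a set `V` of assignments are identified by the syntactic
congruence of a set of terms that is closed under having the same values at `V`. -/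
theorem synRel_of_realize_eq {B Y : Type} {J : Interp L B} {V : Set (Y → B)}
    {Q : Set (Term L Y)}
    (hQ : ∀ t t' : Term L Y, (∀ v ∈ V, t.realize J v = t'.realize J v) → t ∈ Q → t' ∈ Q)
    {t t' : Term L Y} (h : ∀ v ∈ V, t.realize J v = t'.realize J v) :
    synRel (termInterp L Y) Q t t' := by
  have key : ∀ {t t' : Term L Y}, (∀ v ∈ V, t.realize J v = t'.realize J v) →
      ∀ w : Term L (Option (Term L Y)),
      plug (termInterp L Y) w t ∈ Q → plug (termInterp L Y) w t' ∈ Q := by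
    intro t t' h w
    refine hQ _ _ fun v hv => ?_
    unfold plug
    rw [realize_realize, realize_realize]
    congr 1
    funext o
    cases o with
    | none => exact h v hv
    | some c => rfl
  exact fun w => ⟨key h w, key (fun v hv => (h v hv).symm) w⟩

theorem synRel_of_mem_variety {B Y : Type} {J : Interp L B} {V : Set (Y → B)}
    {Q : Set (Term L Y)} {E : Set (Term L ℕ × Term L ℕ)} (hJ : InVariety E J)
    (hQ : ∀ t t' : Term L Y, (∀ v ∈ V, t.realize J v = t'.realize J v) → t ∈ Q → t' ∈ Q) :
    ∀ e ∈ E, ∀ σ : ℕ → Term L Y, synRel (termInterp L Y) Q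
      (e.1.realize (termInterp L Y) σ) (e.2.realize (termInterp L Y) σ) := by
  intro e he σ
  refine synRel_of_realize_eq hQ fun v _ => ?_
  rw [realize_realize, realize_realize]
  exact hJ e he _

/-- Extension of an assignment by a base point. -/
def pt {A X : Type} (z : A) (v : X → A) : Option X → A := fun o => o.elim z v

/-- `r` is a term operation of the algebra `J` expanded by the constant `z`. -/
def Clo {S X : Type} (J : Interp L S) (z : S) (r : (X → S) → S) : Prop :=
  ∃ t : Term L (Option X), ∀ v, r v = t.realize J (pt z v)

namespace Clo

variable {S X Y : Type} {J : Interp L S} {z : S}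

theorem proj (x : X) : Clo J z (fun v : X → S => v x) := ⟨.var (some x), fun _ => rfl⟩

theorem zero : Clo J z (fun _ : X → S => z) := ⟨.var none, fun _ => rfl⟩

theorem term (t : Term L Y) {s : Y → (X → S) → S} (hs : ∀ y, Clo J z (s y)) :
    Clo J z (fun v => t.realize J (fun y => s y v)) := by
  choose σ hσ using hs
  refine ⟨t.realize (termInterp L _) σ, fun v => ?_⟩
  rw [realize_realize]
  simp only [hσ]

theorem comp {r : (Y → S) → S} (hr : Clo J z r) {s : Y → (X → S) → S}
    (hs : ∀ y, Clo J z (s y)) : Clo J z (fun v => r (fun y => s y v)) := by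
  obtain ⟨t, ht⟩ := hr
  have := term (J := J) (z := z) t (s := fun o => o.elim (fun _ => z) s)
    (fun o => by cases o with
      | none => exact zero
      | some y => exact hs y)
  convert this using 2 with v
  rw [ht]
  congr 1
  funext o
  cases o <;> rfl

theorem app₂ {r : S → S → S} (hr : Clo J z (fun v : Fin 2 → S => r (v 0) (v 1)))
    {a b : (X → S) → S} (ha : Clo J z a) (hb : Clo J z b) :
    Clo J z (fun v => r (a v) (b v)) :=
  hr.comp (s := ![a, b]) (by intro i; fin_cases i <;> assumption)

theorem app₃ {r : S → S → S → S} (hr : Clo J z (fun v : Fin 3 → S => r (v 0) (v 1) (v 2)))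
    {a b c : (X → S) → S} (ha : Clo J z a) (hb : Clo J z b) (hc : Clo J z c) :
    Clo J z (fun v => r (a v) (b v) (c v)) :=
  hr.comp (s := ![a, b, c]) (by intro i; fin_cases i <;> assumption)

theorem app₄ {r : S → S → S → S → S}
    (hr : Clo J z (fun v : Fin 4 → S => r (v 0) (v 1) (v 2) (v 3)))
    {a b c d : (X → S) → S} (ha : Clo J z a) (hb : Clo J z b) (hc : Clo J z c)
    (hd : Clo J z d) : Clo J z (fun v => r (a v) (b v) (c v) (d v)) :=
  hr.comp (s := ![a, b, c, d]) (by intro i; fin_cases i <;> assumption)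

theorem term_condition (hJ : IsAbelian J) {r : (X → S) → S} (hr : Clo J z r)
    {v₀₀ v₀₁ v₁₀ v₁₁ : X → S} (hv : IsGrid v₀₀ v₀₁ v₁₀ v₁₁) (h : r v₀₀ = r v₀₁) :
    r v₁₀ = r v₁₁ := by
  obtain ⟨t, ht⟩ := hr
  rw [ht, ht] at h ⊢
  refine hJ.realize_eq t (fun o => ?_) h
  cases o with
  | none => exact .inl ⟨rfl, rfl⟩
  | some x => exact hv x

end Clo

/-- A pointed term operation `W` with `W(x, p, p) = x`; one should think of
`x + λ p - λ q`. -/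
def IsShift {S : Type} (J : Interp L S) (z : S) (W : S → S → S → S) : Prop :=
  Clo J z (fun v : Fin 3 → S => W (v 0) (v 1) (v 2)) ∧ ∀ x p, W x p p = x

namespace IsShift

variable {S : Type} {J : Interp L S} {z : S} {W W' : S → S → S → S}

theorem fst : IsShift J z (fun x _ _ => x) := ⟨.proj 0, fun _ _ => rfl⟩

theorem swap (h : IsShift J z W) : IsShift J z (fun x p q => W x q p) :=
  ⟨h.1.app₃ (.proj 0) (.proj 2) (.proj 1), h.2⟩

theorem comp (h : IsShift J z W) (h' : IsShift J z W') :
    IsShift J z (fun x p q => W (W' x p q) p q) :=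
  ⟨h.1.app₃ h'.1 (.proj 1) (.proj 2), fun x p => by simp only [h.2, h'.2]⟩

theorem cancel (hJ : IsAbelian J) (h : IsShift J z W) (x p : S) :
    W (W x p z) z p = x := by
  have hr : Clo J z (fun v : Fin 4 → S => W (W (v 0) (v 1) (v 2)) z (v 3)) :=
    h.1.app₃ (h.1.app₃ (.proj 0) (.proj 1) (.proj 2)) .zero (.proj 3)
  have := hr.term_condition hJ (v₀₀ := ![x, z, z, p]) (v₀₁ := ![x, z, p, z])
    (v₁₀ := ![x, p, z, p]) (v₁₁ := ![x, p, p, z])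
    (by intro i; fin_cases i <;> simp) (by simp [h.2])
  simpa [h.2] using this

theorem cancel' (hJ : IsAbelian J) (h : IsShift J z W) (x p : S) :
    W (W x z p) p z = x := h.swap.cancel hJ x p

/-- A shift that annihilates its head is a Maltsev operation. -/
theorem left_eq (hJ : IsAbelian J) (h : IsShift J z W) (h0 : ∀ x, W x x z = z) (x y : S) :
    W x x y = y := by
  have hr : Clo J z (fun v : Fin 2 → S => W (v 0) (v 0) (v 1)) :=
    h.1.app₃ (.proj 0) (.proj 0) (.proj 1)
  have key : ∀ x, W z z y = W x x y := fun x => by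
    have := hr.term_condition hJ (v₀₀ := ![z, z]) (v₀₁ := ![x, z])
      (v₁₀ := ![z, y]) (v₁₁ := ![x, y])
      (by intro i; fin_cases i <;> simp) (by simp [h0])
    simpa using this
  rw [← key x, key y, h.2]

theorem exists_iff (hJ : IsAbelian J) {G : S → S → S}
    (hG : Clo J z (fun v : Fin 2 → S => G (v 0) (v 1))) (hG0 : ∀ x, G x z = x)
    {w : S → S → S → S → S}
    (hw : Clo J z (fun v : Fin 4 → S => w (v 0) (v 1) (v 2) (v 3))) :
    (∃ W, IsShift J z W ∧ ∀ x y u, w (G x u) x y u = W y u z) ↔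
      ∃ W, IsShift J z W ∧ ∀ x y u, w x x y u = W y u z := by
  have hshift : ∀ {r : S → S → S → S → S},
      Clo J z (fun v : Fin 4 → S => r (v 0) (v 1) (v 2) (v 3)) →
      (∀ x y, r x x y z = y) → IsShift J z (fun y p q => r (G z p) (G z q) y z) :=
    fun hr h => ⟨hr.app₄ (hG.app₂ .zero (.proj 1)) (hG.app₂ .zero (.proj 2)) (.proj 0) .zero,
      fun _ _ => h _ _⟩
  constructor
  · rintro ⟨W, hW, h⟩
    obtain ⟨r, hrdef⟩ : ∃ r : S → S → S → S → S, r = fun X x y u => W (w X x y u) z u :=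
      ⟨_, rfl⟩
    have hr : Clo J z (fun v : Fin 4 → S => r (v 0) (v 1) (v 2) (v 3)) := by
      subst hrdef
      exact hW.1.app₃ hw .zero (.proj 3)
    have hrG : ∀ x y u, r (G x u) x y u = y := fun x y u => by
      simp only [hrdef, h, hW.cancel hJ]
    have hr0 : ∀ x y, r x x y z = y := fun x y => by simpa [hG0] using hrG x y z
    have h1 : ∀ x y u, r x x y u = r z z y u := fun x y u => by
      have hK : Clo J z (fun v : Fin 3 → S => r (v 0) (v 0) (v 1) (v 2)) :=
        hr.app₄ (.proj 0) (.proj 0) (.proj 1) (.proj 2)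
      have := hK.term_condition hJ (v₀₀ := ![x, y, z]) (v₀₁ := ![z, y, z])
        (v₁₀ := ![x, y, u]) (v₁₁ := ![z, y, u])
        (by intro i; fin_cases i <;> simp) (by simp [hr0])
      simpa using this
    have h2 : ∀ y u, r z z y u = r z (G z u) y z := fun y u => by
      have := hr.term_condition hJ (v₀₀ := ![G z u, z, y, u]) (v₀₁ := ![G z u, G z u, y, z])
        (v₁₀ := ![z, z, y, u]) (v₁₁ := ![z, G z u, y, z])
        (by intro i; fin_cases i <;> simp) (by simp [hr0, hrG])
      simpa using this
    refine ⟨_, hW.comp (hshift hr hr0).swap, fun x y u => ?_⟩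
    simp only [hG0]
    rw [← h2, ← h1 x, hrdef, hW.cancel' hJ]
  · rintro ⟨W, hW, h⟩
    obtain ⟨r, hrdef⟩ : ∃ r : S → S → S → S → S, r = fun X x y u => W (w X x y u) z u :=
      ⟨_, rfl⟩
    have hr : Clo J z (fun v : Fin 4 → S => r (v 0) (v 1) (v 2) (v 3)) := by
      subst hrdef
      exact hW.1.app₃ hw .zero (.proj 3)
    have hr1 : ∀ x y u, r x x y u = y := fun x y u => by
      simp only [hrdef, h, hW.cancel hJ]
    have h1 : ∀ x y u, r (G x u) x y u = r (G z u) z y u := fun x y u => by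
      have hK : Clo J z (fun v : Fin 3 → S => r (G (v 0) (v 2)) (v 0) (v 1) (v 2)) :=
        hr.app₄ (hG.app₂ (.proj 0) (.proj 2)) (.proj 0) (.proj 1) (.proj 2)
      have := hK.term_condition hJ (v₀₀ := ![x, y, z]) (v₀₁ := ![z, y, z])
        (v₁₀ := ![x, y, u]) (v₁₁ := ![z, y, u])
        (by intro i; fin_cases i <;> simp) (by simp [hG0, hr1])
      simpa using this
    have h2 : ∀ y u, r (G z u) z y u = r (G z u) z y z := fun y u => by
      have := hr.term_condition hJ (v₀₀ := ![z, z, y, u]) (v₀₁ := ![z, z, y, z])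
        (v₁₀ := ![G z u, z, y, u]) (v₁₁ := ![G z u, z, y, z])
        (by intro i; fin_cases i <;> simp) (by simp [hr1])
      simpa using this
    refine ⟨_, hW.comp (hshift hr (fun x y => hr1 x y z)), fun x y u => ?_⟩
    simp only [hG0]
    rw [← h2, ← h1 x, hrdef, hW.cancel' hJ]

end IsShift

/-- In an abelian variety every pointed term operation `G` with right unit `z` is given by
a shift. -/
theorem exists_isShift_of_right_unit {S : Type} {J : Interp L S} {z : S}
    {E : Set (Term L ℕ × Term L ℕ)}
    (hab : ∀ (A : Type) (I : Interp L A), InVariety E I → IsAbelian I)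
    (hJ : InVariety E J) {G : S → S → S}
    (hG : Clo J z (fun v : Fin 2 → S => G (v 0) (v 1))) (hG0 : ∀ x, G x z = x) :
    ∃ W, IsShift J z W ∧ ∀ y u, G y u = W y u z := by
  obtain ⟨t, ht⟩ := id hG
  let Q : Set (Term L (Option (Fin 3))) :=
    {c | ∃ W, IsShift J z W ∧ ∀ x y u, c.realize J (pt z ![x, y, u]) = W y u z}
  let σ : Fin 3 → Option (Fin 3) → Option (Fin 2) → Term L (Option (Fin 3)) :=
    fun i o => pt (.var none) ![.var (some i), .var o]
  have hσ : ∀ i o v, (t.realize (termInterp L _) (σ i o)).realize J (pt z v) =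
      G (v i) (pt z v o) := by
    intro i o v
    rw [realize_realize]
    have := ht ![v i, pt z v o]
    simp only [Matrix.cons_val_zero, Matrix.cons_val_one] at this
    rw [this]
    congr 1
    funext k
    rcases k with _ | k
    · rfl
    · fin_cases k <;> rfl
  have key : t.realize (termInterp L _) (σ 1 (some 2)) ∈ Q ↔
      t.realize (termInterp L _) (σ 1 none) ∈ Q := by
    refine synRel.term_condition hab
      (synRel_of_mem_variety (V := Set.range (pt z)) hJ ?_) t
      (v₀₀ := σ 0 (some 2)) (v₀₁ := σ 0 none) ?_ ?_
    · rintro c c' h ⟨W, hW, hc⟩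
      exact ⟨W, hW, fun x y u => by rw [← h _ ⟨_, rfl⟩, hc]⟩
    · intro k
      rcases k with _ | k
      · exact .inl ⟨rfl, rfl⟩
      · fin_cases k
        · exact .inl ⟨rfl, rfl⟩
        · exact .inr ⟨rfl, rfl⟩
    · intro w
      have hw : Clo J z (fun v : Fin 4 → S => w.realize J
          (fun o => o.elim (v 0) (fun c => c.realize J (pt z ![v 1, v 2, v 3])))) := by
        refine .term w (s := fun o v => o.elim (v 0)
          (fun c => c.realize J (pt z ![v 1, v 2, v 3]))) fun o => ?_
        rcases o with _ | c
        · exact .proj 0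
        · refine .term c (s := fun k v => pt z ![v 1, v 2, v 3] k) fun k => ?_
          rcases k with _ | k
          · exact .zero
          · fin_cases k
            · exact .proj 1
            · exact .proj 2
            · exact .proj 3
      have hplug : ∀ (o : Option (Fin 3)) (x y u : S),
          (plug (termInterp L _) w (t.realize (termInterp L _) (σ 0 o))).realize J
            (pt z ![x, y, u]) = w.realize J (fun k => k.elim (G x (pt z ![x, y, u] o))
              (fun c => c.realize J (pt z ![x, y, u]))) := by
        intro o x y u
        unfold plug
        rw [realize_realize]
        congr 1
        funext k
        rcases k with _ | c
        · exact hσ 0 o _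
        · rfl
      have := IsShift.exists_iff (hab _ _ hJ) hG hG0 (w := fun X x y u => w.realize J
          (fun o => o.elim X (fun c => c.realize J (pt z ![x, y, u])))) hw
      have h0 : ∀ x y u : S, pt z ![x, y, u] none = z := fun _ _ _ => rfl
      have h2 : ∀ x y u : S, pt z ![x, y, u] (some 2) = u := fun _ _ _ => rfl
      simp only [Q, Set.mem_ofPred_eq, hplug, h0, h2, hG0]
      exact this
  obtain ⟨W, hW, h⟩ := key.2 ⟨_, .fst, fun x y u => by
    rw [hσ]
    exact hG0 y⟩
  refine ⟨W, hW, fun y u => ?_⟩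
  rw [← h y y u, hσ]
  rfl

/-- The property of being a translate of `x` is preserved when a variable is released
from `z` to `x`. -/
theorem exists_isShift_diag {S : Type} {J : Interp L S} {z : S}
    {E : Set (Term L ℕ × Term L ℕ)}
    (hab : ∀ (A : Type) (I : Interp L A), InVariety E I → IsAbelian I)
    (hJ : InVariety E J) {G : S → S → S}
    (hG : Clo J z (fun v : Fin 2 → S => G (v 0) (v 1)))
    (h : ∃ W, IsShift J z W ∧ ∀ x, G x z = W x x z) :
    ∃ W, IsShift J z W ∧ ∀ x, G x x = W x x z := by
  have hJ' := hab _ _ hJ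
  obtain ⟨W, hW, h⟩ := h
  obtain ⟨W', hW', h'⟩ := exists_isShift_of_right_unit hab hJ
    (G := fun x y => W (G x y) z x) (hW.1.app₃ hG .zero (.proj 0))
    (fun x => by rw [h, hW.cancel hJ'])
  exact ⟨_, hW.comp hW', fun x => by rw [← h', hW.cancel' hJ']⟩

/-- The value `z` is only attained by term operations in a trivial way: it is preserved
when arguments are replaced by `z`. -/
def IsPositive {B : Type} (J : Interp L B) (z : B) : Prop :=
  ∀ (X : Type) (t : Term L X) (v v' : X → B), (∀ x, v' x = v x ∨ v' x = z) →
    t.realize J v = z → t.realize J v' = z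

theorem realize_const {B X : Type} {J : Interp L B} {z : B} (hz : ∀ f, J f (fun _ => z) = z)
    (t : Term L X) : t.realize J (fun _ => z) = z := by
  induction t with
  | var x => rfl
  | app f ts ih => simp only [Term.realize, ih, hz]

theorem exists_isPositive {S : Type} {J : Interp L S} {z : S}
    {E : Set (Term L ℕ × Term L ℕ)}
    (hab : ∀ (A : Type) (I : Interp L A), InVariety E I → IsAbelian I)
    (hJ : InVariety E J) (hz : ∀ f, J f (fun _ => z) = z)
    (hM : ¬ ∃ W, IsShift J z W ∧ ∀ x y, W x x y = y) :
    ∃ (B : Type) (K : Interp L B) (o : B), InVariety E K ∧ (∀ f, K f (fun _ => o) = o) ∧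
      (∃ x, x ≠ o) ∧ IsPositive K o := by
  classical
  let ev : S → Option Unit → S := fun x => pt z (fun _ => x)
  have hev : ∀ c : Term L (Option Unit), c.realize J (ev z) = z := fun c => by
    convert realize_const hz c using 2
    funext o
    rcases o with _ | _ <;> rfl
  let Q : Set (Term L (Option Unit)) :=
    {c | ∃ W, IsShift J z W ∧ ∀ x, c.realize J (ev x) = W x x z}
  have hQ : ∀ t t' : Term L (Option Unit),
      (∀ v ∈ Set.range ev, t.realize J v = t'.realize J v) → t ∈ Q → t' ∈ Q := by
    rintro c c' h ⟨W, hW, hc⟩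
    exact ⟨W, hW, fun x => by rw [← h _ ⟨_, rfl⟩, hc]⟩
  let ρ := synRel (termInterp L (Option Unit)) Q
  have hρ : IsCong (termInterp L (Option Unit)) ρ := synRel_isCong _ _
  refine ⟨Quot ρ, quotInterp _ ρ, Quot.mk ρ (.var none),
    InVariety.quot hρ (synRel_of_mem_variety hJ hQ), fun f => ?_,
    ⟨Quot.mk ρ (.var (some ())), fun h => ?_⟩, ?_⟩
  · rw [← isHom_quot_mk hρ]
    refine Quot.sound (synRel_of_realize_eq hQ ?_)
    rintro _ ⟨x, rfl⟩
    exact hz f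
  · have hmem := ((quot_mk_eq_iff hρ).1 h).mem_iff.1 ⟨_, .fst, fun x => rfl⟩
    obtain ⟨W, hW, h⟩ := hmem
    exact hM ⟨W, hW, hW.left_eq (hab _ _ hJ) fun x => (h x).symm⟩
  · intro X t v v' hv h
    let a : X → Term L (Option Unit) := fun x => (v x).out
    let a' : X → Term L (Option Unit) := fun x => if v' x = v x then a x else .var none
    have ha : v = fun x => Quot.mk ρ (a x) := funext fun x => (Quot.out_eq _).symm
    have ha' : v' = fun x => Quot.mk ρ (a' x) := funext fun x => by
      by_cases hx : v' x = v x
      · simp only [a', if_pos hx, hx]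
        exact (Quot.out_eq _).symm
      · simp only [a', if_neg hx, (hv x).resolve_left hx]
    rw [ha, ← (isHom_quot_mk hρ).realize, quot_mk_eq_iff hρ] at h
    rw [ha', ← (isHom_quot_mk hρ).realize, quot_mk_eq_iff hρ]
    intro w
    let w' : S → S → S := fun Z x => w.realize J (fun k => k.elim Z (fun c => c.realize J (ev x)))
    have hterm : ∀ {Y : Type} (c : Term L (Option Unit)) (y : Y),
        Clo J z (fun v : Y → S => c.realize J (ev (v y))) := by
      intro Y c y
      refine .term c (s := fun k v => ev (v y) k) fun k => ?_
      rcases k with _ | k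
      · exact .zero
      · exact .proj y
    have hw' : Clo J z (fun v : Fin 2 → S => w' (v 0) (v 1)) := by
      refine .term w (s := fun o v => o.elim (v 0) (fun c => c.realize J (ev (v 1)))) fun o => ?_
      rcases o with _ | c
      · exact .proj 0
      · exact hterm c 1
    have hplug : ∀ c x, (plug (termInterp L _) w c).realize J (ev x) =
        w' (c.realize J (ev x)) x := by
      intro c x
      unfold plug
      rw [realize_realize]
      simp only [w']
      congr 1
      funext k
      rcases k with _ | c <;> rfl
    have hmem : ∀ c, plug (termInterp L _) w c ∈ Q ↔
        ∃ W, IsShift J z W ∧ ∀ x, w' (c.realize J (ev x)) x = W x x z := by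
      intro c
      simp only [Q, Set.mem_ofPred_eq, hplug]
    have hw := h w
    rw [hmem, hmem] at hw ⊢
    simp only [realize_realize] at hw ⊢
    constructor
    · rintro ⟨W, hW, hx⟩
      refine hw.1 (exists_isShift_diag hab hJ
        (G := fun x y => w' (t.realize J (fun i => if v' i = v i then (a i).realize J (ev x)
          else (a i).realize J (ev y))) x) ?_ ⟨W, hW, fun x => ?_⟩ |>.imp fun W' h' => ?_)
      · refine hw'.app₂ (.term t (s := fun i v => if v' i = _ then (a i).realize J (ev (v 0))
          else (a i).realize J (ev (v 1))) fun i => ?_) (.proj 0)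
        split_ifs
        · exact hterm _ 0
        · exact hterm _ 1
      · rw [← hx]
        congr 3
        funext i
        simp only [a', hev]
        split_ifs <;> rfl
      · simpa only [ite_self] using h'
    · rintro ⟨W, hW, hx⟩
      refine exists_isShift_diag hab hJ
        (G := fun x y => w' (t.realize J (fun i => (a' i).realize J (ev y))) x)
        (hw'.app₂ (.term t fun i => hterm _ 1) (.proj 0)) ⟨W, hW, fun x => ?_⟩
      rw [← hx]
      simp only [hev, realize_const hz]
      rfl

/-- Every pointed algebra `A` of an abelian variety has a subtraction into a pointed algebra
of the variety, which is a homomorphism and vanishes exactly on the diagonal. -/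
theorem exists_subtraction {A : Type} {I : Interp L A} {E : Set (Term L ℕ × Term L ℕ)}
    (hab : ∀ (A : Type) (I : Interp L A), InVariety E I → IsAbelian I)
    (hI : InVariety E I) (e : A) :
    ∃ (S : Type) (J : Interp L S) (z : S) (δ : A → A → S), InVariety E J ∧
      (∀ a b, δ a b = z ↔ a = b) ∧ IsHom (pairInterp I) J (fun x => δ x.1 x.2) := by
  let Q : Set (A × A) := {x | x.1 = x.2}
  have hρ : IsCong (pairInterp I) (synRel (pairInterp I) Q) := synRel_isCong _ _
  have hfst : IsHom (pairInterp I) I Prod.fst := fun _ _ => rfl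
  have hsnd : IsHom (pairInterp I) I Prod.snd := fun _ _ => rfl
  refine ⟨_, quotInterp _ _, Quot.mk (synRel (pairInterp I) Q) (e, e), fun a b => Quot.mk _ (a, b),
    InVariety.quot hρ fun t ht v => ?_, fun a b => ?_, isHom_quot_mk hρ⟩
  · have : t.1.realize (pairInterp I) v = t.2.realize (pairInterp I) v := by
      ext
      · rw [hfst.realize, hfst.realize, hI t ht]
      · rw [hsnd.realize, hsnd.realize, hI t ht]
    rw [this]
    exact fun _ => Iff.rfl
  · rw [quot_mk_eq_iff hρ]
    refine ⟨fun h => h.mem_iff.2 rfl, ?_⟩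
    rintro rfl w
    have hdiag : ∀ c : A, plug (pairInterp I) w (c, c) ∈ Q ↔
        w.realize I (fun o => (o.elim (c, c) id).1) =
          w.realize I (fun o => (o.elim (c, c) id).2) := by
      intro c
      simp only [Q, Set.mem_ofPred_eq, plug, hfst.realize, hsnd.realize]
    have hgrid : ∀ c d : A, IsGrid (fun o : Option (A × A) => (o.elim (c, c) id).1)
        (fun o => (o.elim (c, c) id).2) (fun o => (o.elim (d, d) id).1)
        (fun o => (o.elim (d, d) id).2) := by
      intro c d o
      rcases o with _ | x
      · exact .inl ⟨rfl, rfl⟩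
      · exact .inr ⟨rfl, rfl⟩
    rw [hdiag, hdiag]
    exact ⟨(hab A I hI).realize_eq w (hgrid _ _), (hab A I hI).realize_eq w (hgrid _ _)⟩

/-- If the algebra of differences has a pointed Maltsev term operation, then the original
algebra has a Maltsev polynomial operation. -/
theorem hasMaltsevPoly_of_subtraction {A S : Type} {I : Interp L A} {J : Interp L S} {z : S}
    (hJ : IsAbelian J) (e : A) {δ : A → A → S} (hδ : ∀ a b, δ a b = z ↔ a = b)
    (hhom : IsHom (pairInterp I) J (fun x => δ x.1 x.2)) {p : S → S → S → S}
    (hp : IsShift J z p) (hleft : ∀ x y, p x x y = y) : HasMaltsevPoly I := by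
  obtain ⟨t, ht⟩ := id hp.1
  obtain ⟨P, hP⟩ : ∃ P : A → A → A → A, ∀ a b c, P a b c = t.realize I (pt e ![a, b, c]) :=
    ⟨_, fun _ _ _ => rfl⟩
  have hδP : ∀ a b c a' b' c',
      δ (P a b c) (P a' b' c') = p (δ a a') (δ b b') (δ c c') := by
    intro a b c a' b' c'
    have hfst : IsHom (pairInterp I) I Prod.fst := fun _ _ => rfl
    have hsnd : IsHom (pairInterp I) I Prod.snd := fun _ _ => rfl
    have h := hhom.realize (pt (e, e) ![(a, a'), (b, b'), (c, c')]) t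
    simp only [hfst.realize, hsnd.realize] at h
    have h' := ht ![δ a a', δ b b', δ c c']
    simp only [Matrix.cons_val] at h'
    rw [hP, hP, h']
    convert h using 2
    · congr 1
      funext o
      rcases o with _ | i
      · rfl
      · fin_cases i <;> rfl
    · congr 1
      funext o
      rcases o with _ | i
      · rfl
      · fin_cases i <;> rfl
    · funext o
      rcases o with _ | i
      · exact ((hδ e e).2 rfl).symm
      · fin_cases i <;> rfl
  have hself : ∀ a, δ a a = z := fun a => (hδ a a).2 rfl
  have hinj : ∀ {a a' b}, δ a b = δ a' b → a = a' := by
    intro a a' b h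
    have h1 : P a a' e = P b b e := (hδ _ _).1 (by rw [hδP, h, hself, hleft])
    have h2 : P a' a' e = P b b e := (hδ _ _).1 (by rw [hδP, hself, hleft])
    rw [← hδ]
    calc δ a a' = p (δ a a') (δ a' a') (δ e e) := by rw [hself, hself, hp.2]
      _ = z := by rw [← hδP, h1, h2, hself]
  have hκ : ∀ {a b}, P a a a = P b b b → a = b := by
    intro a b h
    rw [← hδ, ← hp.2 (δ a b) (δ a b), ← hδP, h, hself]
  have hκr : ∀ x y, P x y y = P x x x := fun x y => by rw [← hδ, hδP, hp.2, hself]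
  have hκl : ∀ x y, P y y x = P x x x := fun x y => by rw [← hδ, hδP, hleft, hself]
  have hgroup : ∀ k, p (p z k z) z k = z := by
    intro k
    have hr : Clo J z (fun v : Fin 4 → S => p (p z (v 0) (v 1)) (v 2) (v 3)) :=
      hp.1.app₃ (hp.1.app₃ .zero (.proj 0) (.proj 1)) (.proj 2) (.proj 3)
    have := hr.term_condition hJ (v₀₀ := ![z, z, z, k]) (v₀₁ := ![z, k, z, z])
      (v₁₀ := ![k, z, z, k]) (v₁₁ := ![k, k, z, z])
      (by intro i; fin_cases i <;> simp) (by simp [hp.2, hleft])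
    simpa [hp.2] using this
  have hη : ∀ y, P y (P y y y) y = y := by
    intro y
    refine hκ ?_
    rw [← hκr _ (P y y y), ← hδ]
    calc δ (P (P y (P y y y) y) (P y y y) (P y y y)) (P y y y)
        = δ (P (P y (P y y y) y) (P y y y) (P y y y)) (P (P y y y) (P y y y) y) := by
          rw [hκl y (P y y y)]
      _ = p (δ (P y (P y y y) y) (P y y y)) z (δ (P y y y) y) := by rw [hδP, hself]
      _ = z := by rw [hδP, hself, hgroup]
  refine ⟨fun v => P (v 0) (P (v 1) (v 1) (v 1)) (v 2), ?_, fun x y => ⟨?_, ?_⟩⟩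
  · refine ⟨1, t.realize (termInterp L _) (pt (.var (.inr 0)) ![.var (.inl 0),
      t.realize (termInterp L _) (pt (.var (.inr 0)) (fun _ => .var (.inl 1))),
      .var (.inl 2)]), fun _ => e, fun v => ?_⟩
    change P (v 0) (P (v 1) (v 1) (v 1)) (v 2) = _
    rw [realize_realize, hP, hP]
    congr 1
    funext o
    rcases o with _ | i
    · rfl
    · fin_cases i
      · rfl
      · refine Eq.trans ?_ (realize_realize _ _ _ _).symm
        change t.realize I _ = _
        congr 1
        funext o
        rcases o with _ | i
        · rfl
        · fin_cases i <;> rfl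
      · rfl
  · change P x (P y y y) y = x
    refine hinj (b := y) ?_
    calc δ (P x (P y y y) y) y = δ (P x (P y y y) y) (P y (P y y y) y) := by rw [hη]
      _ = δ x y := by rw [hδP, hself, hself, hp.2]
  · change P y (P y y y) x = x
    refine hinj (b := y) ?_
    calc δ (P y (P y y y) x) y = δ (P y (P y y y) x) (P y (P y y y) y) := by rw [hη]
      _ = δ x y := by rw [hδP, hself, hself, hleft]

/-- An algebra of an abelian variety that satisfies the identities of a positive algebra
of the variety is strongly rectangular. -/
theorem isStronglyRectangular_of_isPositive {B M : Type} {J : Interp L B} {K : Interp L M}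
    {z : B} {E : Set (Term L ℕ × Term L ℕ)}
    (hab : ∀ (A : Type) (I : Interp L A), InVariety E I → IsAbelian I)
    (hJ : InVariety E J) (hz : ∀ f, J f (fun _ => z) = z) (hpos : IsPositive J z)
    (hK : ∀ (Y : Type) (t t' : Term L Y), (∀ v, t.realize J v = t'.realize J v) →
      ∀ μ, t.realize K μ = t'.realize K μ) : IsStronglyRectangular K := by
  rintro _ q _ _ ⟨k, l, _, ⟨m, τ, c, ht⟩, a, b, u, v, rfl, rfl, rfl, rfl⟩ hqr
  simp only [ht] at hqr ⊢
  let Y : Type := Bool × (Fin k ⊕ Fin l) ⊕ Fin m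
  let σ : Bool → Bool → (Fin k ⊕ Fin l) ⊕ Fin m → Term L Y := fun i j =>
    Sum.elim (Sum.elim (fun n => .var (.inl (i, .inl n))) (fun n => .var (.inl (j, .inr n))))
      (fun n => .var (.inr n))
  let μ : Y → M := Sum.elim
    (fun x => bif x.1 then Sum.elim b v x.2 else Sum.elim a u x.2) c
  let ev : (Fin k → B) → Y → B := fun ξ => Sum.elim
    (fun x => bif x.1 then z else Sum.elim ξ (fun _ => z) x.2) (fun _ => z)
  let T : Bool → Bool → Term L Y := fun i j => τ.realize (termInterp L Y) (σ i j)
  have hTμ : ∀ i j, (T i j).realize K μ = τ.realize K (Sum.elim (Sum.elim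
      (bif i then b else a) (bif j then v else u)) c) := by
    intro i j
    rw [realize_realize]
    congr 1
    funext x
    rcases x with (x | x) | x <;> cases i <;> cases j <;> rfl
  let Q : Set (Term L Y) := {w | (∀ ξ, w.realize J (ev ξ) = z) ∧
    w.realize K μ = (T true false).realize K μ}
  have hmem : T true false ∈ Q := by
    refine ⟨fun ξ => ?_, rfl⟩
    rw [realize_realize]
    convert realize_const hz τ using 2
    funext x
    rcases x with (x | x) | x <;> rfl
  have key : T true false ∈ Q ↔ T true true ∈ Q := by
    refine synRel.term_condition hab (synRel_of_mem_variety (V := Set.univ) hJ ?_) τ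
      (v₀₀ := σ false false) (v₀₁ := σ false true) ?_ ?_
    · rintro w w' h ⟨h1, h2⟩
      exact ⟨fun ξ => by rw [← h _ trivial, h1], by rw [← hK _ _ _ (fun v => h v trivial), h2]⟩
    · rintro ((x | x) | x)
      · exact .inl ⟨rfl, rfl⟩
      · exact .inr ⟨rfl, rfl⟩
      · exact .inl ⟨rfl, rfl⟩
    · intro w
      have hplug : ∀ {A : Type} (I : Interp L A) (s : Term L Y) (ν : Y → A),
          (plug (termInterp L Y) w s).realize I ν =
            w.realize I (fun o => o.elim (s.realize I ν) (fun c => c.realize I ν)) := by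
        intro A I s ν
        unfold plug
        rw [realize_realize]
        congr 1
        funext o
        rcases o with _ | c <;> rfl
      have hev : ∀ ξ, (T false false).realize J (ev ξ) = (T false true).realize J (ev ξ) := by
        intro ξ
        rw [realize_realize, realize_realize]
        congr 1
        funext x
        rcases x with (x | x) | x <;> rfl
      let W : Term L (Fin k ⊕ Y) := w.realize (termInterp L _) (fun o => o.elim
        (τ.realize (termInterp L _) (Sum.elim (Sum.elim (fun n => .var (.inl n))
          (fun n => .var (.inr (.inl (false, .inr n))))) (fun n => .var (.inr (.inr n)))))
        (fun c => c.relabel .inr))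
      have hW : ∀ (i : Bool) (ν : Y → B), (plug (termInterp L Y) w (T i false)).realize J ν =
          W.realize J (Sum.elim (fun n => ν (.inl (i, .inl n))) ν) := by
        intro i ν
        refine (hplug J _ ν).trans (Eq.trans ?_ (realize_realize _ _ _ w).symm)
        congr 1
        funext o
        rcases o with _ | c
        · change (T i false).realize J ν = Term.realize J _ (Term.realize _ _ τ)
          rw [realize_realize, realize_realize]
          congr 1
          funext x
          rcases x with (x | x) | x <;> rfl
        · exact (realize_relabel J Sum.inr (Sum.elim (fun n => ν (.inl (i, .inl n))) ν) c).symm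
      have hiff : (∀ ξ, (plug (termInterp L Y) w (T false false)).realize J (ev ξ) = z) →
          (plug (termInterp L Y) w (T false false)).realize K μ =
            (plug (termInterp L Y) w (T false true)).realize K μ := by
        intro h
        have h0 : ∀ ξ, W.realize J (Sum.elim ξ (fun _ => z)) = z := by
          intro ξ
          refine hpos _ W (Sum.elim ξ (ev ξ)) _ ?_ ((hW false (ev ξ)).symm.trans (h ξ))
          rintro (x | x)
          · exact .inl rfl
          · exact .inr rfl
        have hid : ∀ ν, (plug (termInterp L Y) w (T false false)).realize J ν =
            (plug (termInterp L Y) w (T true false)).realize J ν := by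
          intro ν
          rw [hW, hW]
          refine (hab _ _ hJ).realize_eq W ?_
            ((h0 fun n => ν (.inl (false, .inl n))).trans (h0 fun n => ν (.inl (true, .inl n))).symm)
          rintro (x | x)
          · exact .inr ⟨rfl, rfl⟩
          · exact .inl ⟨rfl, rfl⟩
        have hq : (T true false).realize K μ = (T false true).realize K μ := by
          rw [hTμ, hTμ]
          exact hqr.symm
        rw [hK _ _ _ hid, hplug, hplug, hq]
      have hB : (∀ ξ, (plug (termInterp L Y) w (T false false)).realize J (ev ξ) = z) ↔
          ∀ ξ, (plug (termInterp L Y) w (T false true)).realize J (ev ξ) = z := by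
        simp only [hplug, hev]
      constructor
      · rintro ⟨h1, h2⟩
        exact ⟨hB.1 h1, (hiff h1).symm.trans h2⟩
      · rintro ⟨h1, h2⟩
        exact ⟨hB.2 h1, (hiff (hB.2 h1)).trans h2⟩
  have := (key.1 hmem).2
  rw [hTμ, hTμ] at this
  exact this.symm

/-- Algebras in the variety generated by `B` satisfy the identities of `B`. -/
theorem realize_eq_of_surjective {B ι M : Type} {J : Interp L B} {S : Set (ι → B)}
    {hS : IsSubuniverse (prodInterp (fun _ : ι => J)) S} {K : Interp L M} {h : S → M}
    (hh : IsHom (subInterp (prodInterp (fun _ : ι => J)) S hS) K h)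
    (hsurj : Function.Surjective h) {Y : Type} {t t' : Term L Y}
    (ht : ∀ v, t.realize J v = t'.realize J v) (μ : Y → M) :
    t.realize K μ = t'.realize K μ := by
  choose g hg using fun y => hsurj (μ y)
  obtain rfl : (fun y => h (g y)) = μ := funext hg
  rw [← hh.realize, ← hh.realize]
  congr 1
  refine Subtype.ext (funext fun i => ?_)
  have hcoord : IsHom (subInterp (prodInterp (fun _ : ι => J)) S hS) J (fun s => s.1 i) :=
    fun _ _ => rfl
  rw [hcoord.realize, hcoord.realize, ht]

/-- If every member of the variety `Mod(E)` is abelian and some member is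
not affine, then there is a member `B` of `Mod(E)` with more than one element such that
every surjective-homomorphic image of a substructure of a power of `B` is strongly
abelian (the subvariety generated by `B` is a nontrivial strongly abelian variety). -/
theorem statement2 {L : Lang} (E : Set (Term L ℕ × Term L ℕ))
    (habelian : ∀ (A : Type) (I : Interp L A), InVariety E I → IsAbelian I)
    (hnotaffine : ∃ (A : Type) (I : Interp L A), InVariety E I ∧ ¬ HasMaltsevPoly I) :
    ∃ (B : Type) (J : Interp L B),
      InVariety E J ∧ (∃ x y : B, x ≠ y) ∧
      ∀ (ι : Type) (S : Set (ι → B))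
        (hS : IsSubuniverse (prodInterp (fun _ : ι => J)) S)
        (M : Type) (K : Interp L M) (h : S → M),
        IsHom (subInterp (prodInterp (fun _ : ι => J)) S hS) K h →
        Function.Surjective h → IsStronglyAbelian K := by
  obtain ⟨A, I, hI, hnot⟩ := hnotaffine
  have hA : Nonempty A := by
    by_contra hA
    rw [not_nonempty_iff] at hA
    exact hnot ⟨fun v => v 0, ⟨0, .var (.inl 0), Fin.elim0, fun _ => rfl⟩, fun x => hA.elim x⟩
  obtain ⟨e⟩ := hA
  obtain ⟨S, J, z, δ, hJ, hδ, hhom⟩ := exists_subtraction habelian hI e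
  have hδe : δ e e = z := (hδ e e).2 rfl
  have hz : ∀ f, J f (fun _ => z) = z := fun f => by
    rw [← hδe]
    exact (hhom f fun _ => (e, e)).symm.trans (((hδ _ _).2 rfl).trans hδe.symm)
  obtain ⟨B, K, o, hK, ho, ⟨x, hx⟩, hpos⟩ := exists_isPositive habelian hJ hz
    fun ⟨_, hW, hleft⟩ =>
      hnot (hasMaltsevPoly_of_subtraction (habelian _ _ hJ) e hδ hhom hW hleft)
  refine ⟨B, K, hK, ⟨x, o, hx⟩, fun ι S hS M N h hh hsurj => ?_⟩
  have hN : ∀ (Y : Type) (t t' : Term L Y), (∀ v, t.realize K v = t'.realize K v) →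
      ∀ μ, t.realize N μ = t'.realize N μ :=
    fun Y t t' ht => realize_eq_of_surjective hh hsurj ht
  exact ⟨habelian M N fun t ht => hN _ _ _ (hK t ht),
    isStronglyRectangular_of_isPositive habelian hK ho hpos hN⟩

end UA
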